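/- arXiv:2408.13428 — 2 statements merged into one kernel-verified Lean document; each statement's English description precedes it below -/
import Mathlib

section
/- Finite-dimensional homological equation solved by the Lyapunov–Perron integral (Steps 1–2 of Theorem II.1 of the paper, diagonal real case): Let m ≥ 1, k ≥ 1 be integers, let λ_1, …, λ_m, λ_n ∈ ℝ, and let G_k : ℝ^m → ℝ be the homogeneous degree-k polynomial G_k(x) = Σ_{(j_1,…,j_k) ∈ {1,…,m}^k} G^{j_1…j_k} x_{j_1} ⋯ x_{j_k} with real coefficients G^{j_1…j_k}. Let z = (z_1, …, z_m) : ℝ → ℝ^m be continuous with each z_j of sublinear growth at −∞, i.e. z_j(s)/s → 0 as s → −∞. Assume the non-resonance condition: for every tuple (j_1,…,j_k) with G^{j_1…j_k} ≠ 0 and every subset T ⊆ {1,…,k}, λ_n − Σ_{p∈T} λ_{j_p} < 0. Then for every t ∈ ℝ and X ∈ ℝ^m the integrand s ↦ e^{(t−s)λ_n} G_k( (e^{(s−t)λ_j} X_j + z_j(s))_{j=1,…,m} ) is integrable on (−∞, t], so that ψ(t, X) = ∫_{−∞}^t e^{(t−s)λ_n} G_k( (e^{(s−t)λ_j} X_j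 + z_j(s))_j ) ds is well defined; moreover ψ has a partial derivative in t and partial derivatives in each X_j, and it satisfies the homological equation ∂_t ψ(t,X) + Σ_{j=1}^m λ_j X_j ∂_{X_j} ψ(t,X) − λ_n ψ(t,X) = G_k( X + z(t) ) for all t ∈ ℝ and X ∈ ℝ^m. -/
open MeasureTheory Filter

open Asymptotics in
/-- A finite product of functions of sublinear growth at `-∞`, damped by a decaying exponential,
is integrable on every half-line `(-∞, t]`. -/
theorem integrableOn_exp_mul_prod_Iic {ι : Type*} (S : Finset ι) (f : ι → ℝ → ℝ)
    (hf : ∀ i ∈ S, Continuous (f i))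
    (hsub : ∀ i ∈ S, Tendsto (fun s : ℝ => f i s / s) atBot (nhds 0))
    {b : ℝ} (hb : 0 < b) (t : ℝ) :
    IntegrableOn (fun s => Real.exp (b * s) * ∏ i ∈ S, f i s) (Set.Iic t) := by
  have hcont : Continuous fun s => Real.exp (b * s) * ∏ i ∈ S, f i s :=
    (by fun_prop : Continuous fun s : ℝ => Real.exp (b * s)).mul
      (continuous_finsetProd S hf)
  have hprod : (fun s => ∏ i ∈ S, f i s) =O[atBot] fun s : ℝ => s ^ S.card := by
    have h := IsBigO.finsetProd (s := S) (f := f) (g := fun _ s => s) (l := atBot)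
      (fun i hi => ((isLittleO_iff_tendsto' (by
        filter_upwards [eventually_lt_atBot 0] with s hs h0
        exact absurd h0 hs.ne)).2 (hsub i hi)).isBigO)
    simpa using h
  have hpow : (fun s : ℝ => s ^ S.card) =O[atBot] fun s : ℝ => Real.exp (-(b / 2) * s) := by
    have h := (isLittleO_pow_exp_pos_mul_atTop S.card (half_pos hb)).isBigO.comp_tendsto
      tendsto_neg_atBot_atTop
    refine IsBigO.of_norm_left ?_
    refine h.norm_left.congr (fun s => ?_) (fun s => ?_)
    · simp
    · simp
  refine (hcont.locallyIntegrable.locallyIntegrableOn _).integrableOn_of_isBigO_atBot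
    (g := fun s => Real.exp (b / 2 * s)) ?_
    ⟨Set.Iic 0, Iic_mem_atBot 0, integrableOn_exp_mul_Iic (half_pos hb) 0⟩
  refine ((isBigO_refl (fun s : ℝ => Real.exp (b * s)) atBot).mul (hprod.trans hpow)).congr_right
    fun s => ?_
  rw [← Real.exp_add]
  ring_nf

/-- Fundamental theorem of calculus on `(-∞, t]`. -/
theorem hasDerivAt_integral_Iic {f : ℝ → ℝ} (hf : Continuous f)
    (hint : ∀ t, IntegrableOn f (Set.Iic t)) (t : ℝ) :
    HasDerivAt (fun u => ∫ s in Set.Iic u, f s) (f t) t := by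
  have h := (intervalIntegral.integral_hasDerivAt_right (hf.intervalIntegrable t t)
    hf.stronglyMeasurable.stronglyMeasurableAtFilter hf.continuousAt).const_add
    (∫ s in Set.Iic t, f s)
  refine h.congr_of_eventuallyEq (Eventually.of_forall fun u => ?_)
  simp only
  rw [← intervalIntegral.integral_Iic_sub_Iic (hint t) (hint u)]
  ring

/-- Partial derivative of a monomial `∏ p ∈ T, x (jv p)`. -/
theorem hasDerivAt_prod_update {ι κ : Type*} [DecidableEq ι] [DecidableEq κ] (T : Finset κ)
    (jv : κ → ι) (X : ι → ℝ) (j : ι) :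
    HasDerivAt (fun a => ∏ p ∈ T, Function.update X j a (jv p))
      (∑ p ∈ T, (∏ q ∈ T.erase p, X (jv q)) * Pi.single (M := fun _ => ℝ) j 1 (jv p)) (X j) := by
  have h := HasDerivAt.fun_finsetProd (u := T) (x := X j)
    (f := fun p a => Function.update X j a (jv p))
    (f' := fun p => Pi.single (M := fun _ => ℝ) j 1 (jv p)) fun p _ => by
      classical
      by_cases hp : jv p = j
      · simpa [hp] using hasDerivAt_id' (X j)
      · simpa [hp] using hasDerivAt_const (X j) (X (jv p))
  simpa using h

/-- Weighted Euler identity for the monomial `∏ p ∈ T, x (jv p)`. -/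
theorem sum_weight_mul_partial_prod {ι κ : Type*} [Fintype ι] [DecidableEq ι] [DecidableEq κ]
    (T : Finset κ) (jv : κ → ι) (w X : ι → ℝ) :
    ∑ j, w j * X j *
      ∑ p ∈ T, (∏ q ∈ T.erase p, X (jv q)) * Pi.single (M := fun _ => ℝ) j 1 (jv p)
      = (∑ p ∈ T, w (jv p)) * ∏ p ∈ T, X (jv p) := by
  simp_rw [Finset.mul_sum]
  rw [Finset.sum_comm, Finset.sum_mul]
  refine Finset.sum_congr rfl fun p hp => ?_
  rw [Finset.sum_eq_single (jv p)]
  · rw [← Finset.mul_prod_erase T (fun q => X (jv q)) hp]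
    simp
    ring
  · intro j _ hj
    simp [Pi.single_eq_of_ne hj.symm]
  · simp

/-- Expansion of the Lyapunov–Perron integrand into damped monomials. -/
theorem lyapunovPerron_integrand_expand {m k : ℕ} (lam : Fin m → ℝ) (lamn : ℝ)
    (G : (Fin k → Fin m) → ℝ) (X y : Fin m → ℝ) (t s : ℝ) :
    Real.exp ((t - s) * lamn) *
        ∑ jv : Fin k → Fin m, G jv * ∏ p, (Real.exp ((s - t) * lam (jv p)) * X (jv p) + y (jv p))
      = ∑ jv : Fin k → Fin m, ∑ T : Finset (Fin k),
        (G jv * (∏ p ∈ T, X (jv p)) * Real.exp ((lamn - ∑ p ∈ T, lam (jv p)) * t)) *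
          (Real.exp (-(lamn - ∑ p ∈ T, lam (jv p)) * s) * ∏ p ∈ Tᶜ, y (jv p)) := by
  rw [Finset.mul_sum]
  refine Finset.sum_congr rfl fun jv _ => ?_
  rw [Fintype.prod_add, Finset.mul_sum, Finset.mul_sum]
  refine Finset.sum_congr rfl fun T _ => ?_
  have hexp : Real.exp ((t - s) * lamn) * Real.exp (∑ p ∈ T, (s - t) * lam (jv p))
      = Real.exp ((lamn - ∑ p ∈ T, lam (jv p)) * t) *
        Real.exp (-(lamn - ∑ p ∈ T, lam (jv p)) * s) := by
    rw [← Real.exp_add, ← Real.exp_add, ← Finset.mul_sum]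
    ring_nf
  rw [Finset.prod_mul_distrib, ← Real.exp_sum]
  linear_combination (G jv * (∏ p ∈ T, X (jv p)) * ∏ p ∈ Tᶜ, y (jv p)) * hexp

/-- Finite-dimensional homological equation solved by the Lyapunov–Perron integral
(Steps 1–2 of Theorem II.1 of the paper, diagonal real case). Under the non-resonance
condition, the Lyapunov–Perron integrand is integrable on `(-∞, t]`, the integral
`ψ(t,X)` admits a partial derivative in `t` and partial derivatives in each `X_j`, and
`∂_t ψ + Σ_j λ_j X_j ∂_{X_j} ψ - λ_n ψ = G_k(X + z(t))`. -/
theorem lyapunov_perron_solves_homological_equation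
    (m k : ℕ) (hm : 1 ≤ m) (hk : 1 ≤ k)
    (lam : Fin m → ℝ) (lamn : ℝ)
    (G : (Fin k → Fin m) → ℝ)
    (Gk : (Fin m → ℝ) → ℝ)
    (hGk : ∀ x : Fin m → ℝ, Gk x = ∑ jv : Fin k → Fin m, G jv * ∏ p, x (jv p))
    (z : ℝ → Fin m → ℝ) (hz_cont : Continuous z)
    (hz_sub : ∀ j, Tendsto (fun s : ℝ => z s j / s) atBot (nhds 0))
    (hNR : ∀ jv : Fin k → Fin m, G jv ≠ 0 → ∀ T : Finset (Fin k),
      lamn - ∑ p ∈ T, lam (jv p) < 0)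
    (ψ : ℝ → (Fin m → ℝ) → ℝ)
    (hψ : ∀ t X, ψ t X = ∫ s in Set.Iic t,
      Real.exp ((t - s) * lamn) *
        Gk (fun j => Real.exp ((s - t) * lam j) * X j + z s j)) :
    (∀ t : ℝ, ∀ X : Fin m → ℝ,
      IntegrableOn
        (fun s : ℝ => Real.exp ((t - s) * lamn) *
          Gk (fun j => Real.exp ((s - t) * lam j) * X j + z s j))
        (Set.Iic t) (volume : Measure ℝ)) ∧
    (∀ t : ℝ, ∀ X : Fin m → ℝ, ∃ dt : ℝ, ∃ dX : Fin m → ℝ,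
      HasDerivAt (fun t' => ψ t' X) dt t ∧
      (∀ j, HasDerivAt (fun a => ψ t (Function.update X j a)) (dX j) (X j)) ∧
      dt + (∑ j, lam j * X j * dX j) - lamn * ψ t X
        = Gk (fun j => X j + z t j)) := by
  classical
  set μ : (Fin k → Fin m) → Finset (Fin k) → ℝ := fun jv T => lamn - ∑ p ∈ T, lam (jv p) with hμ
  set h : (Fin k → Fin m) → Finset (Fin k) → ℝ → ℝ :=
    fun jv T s => Real.exp (-μ jv T * s) * ∏ p ∈ Tᶜ, z s (jv p)
  set c : (Fin k → Fin m) → Finset (Fin k) → ℝ → (Fin m → ℝ) → ℝ :=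
    fun jv T t X => G jv * (∏ p ∈ T, X (jv p)) * Real.exp (μ jv T * t) with hc
  have hz (j : Fin m) : Continuous fun s => z s j := (continuous_apply j).comp hz_cont
  have hcont (jv T) : Continuous (h jv T) :=
    (by fun_prop : Continuous fun s : ℝ => Real.exp (-μ jv T * s)).mul
      (continuous_finsetProd _ fun p _ => hz (jv p))
  have hint (jv T) (hG : G jv ≠ 0) (t : ℝ) : IntegrableOn (h jv T) (Set.Iic t) :=
    integrableOn_exp_mul_prod_Iic Tᶜ (fun p s => z s (jv p)) (fun p _ => hz (jv p))
      (fun p _ => hz_sub (jv p)) (neg_pos.2 (hNR jv hG T)) t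
  have hexpand (t X) : (fun s : ℝ => Real.exp ((t - s) * lamn) *
      Gk (fun j => Real.exp ((s - t) * lam j) * X j + z s j))
      = fun s => ∑ jv, ∑ T, c jv T t X * h jv T s := by
    funext s
    rw [hGk]
    exact lyapunovPerron_integrand_expand lam lamn G X (z s) t s
  have hterm (t X jv T) : IntegrableOn (fun s => c jv T t X * h jv T s) (Set.Iic t) := by
    by_cases hG : G jv = 0
    · simp [hc, hG]
    · exact (hint jv T hG t).const_mul _
  have hψ' (t X) : ψ t X = ∑ jv, ∑ T, c jv T t X * ∫ s in Set.Iic t, h jv T s := by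
    rw [hψ, hexpand,
      integral_finsetSum _ fun jv _ => integrable_finsetSum _ fun T _ => hterm t X jv T]
    refine Finset.sum_congr rfl fun jv _ => ?_
    rw [integral_finsetSum _ fun T _ => hterm t X jv T]
    exact Finset.sum_congr rfl fun T _ => integral_const_mul _ _
  refine ⟨fun t X => ?_, fun t X => ?_⟩
  · rw [hexpand]
    exact integrable_finsetSum _ fun jv _ => integrable_finsetSum _ fun T _ => hterm t X jv T
  have ht (jv T) : HasDerivAt (fun t' => c jv T t' X * ∫ s in Set.Iic t', h jv T s)
      (μ jv T * (c jv T t X * ∫ s in Set.Iic t, h jv T s) + c jv T t X * h jv T t) t := by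
    by_cases hG : G jv = 0
    · simpa [hc, hG] using hasDerivAt_const t (0 : ℝ)
    · have h1 : HasDerivAt (fun t' => c jv T t' X) (c jv T t X * μ jv T) t := by
        have := (((hasDerivAt_id t).const_mul (μ jv T)).exp).const_mul (G jv * ∏ p ∈ T, X (jv p))
        refine this.congr_deriv ?_
        simp [hc]
        ring
      refine (h1.mul (hasDerivAt_integral_Iic (hcont jv T) (hint jv T hG) t)).congr_deriv ?_
      ring
  have hX (j jv T) : HasDerivAt
      (fun a => c jv T t (Function.update X j a) * ∫ s in Set.Iic t, h jv T s)
      (G jv * (∑ p ∈ T, (∏ q ∈ T.erase p, X (jv q)) * Pi.single (M := fun _ => ℝ) j 1 (jv p)) *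
        Real.exp (μ jv T * t) * ∫ s in Set.Iic t, h jv T s) (X j) :=
    (((hasDerivAt_prod_update T jv X j).const_mul _).mul_const _).mul_const _
  have hψt := HasDerivAt.fun_sum fun jv (_ : jv ∈ Finset.univ) =>
    HasDerivAt.fun_sum fun T (_ : T ∈ Finset.univ) => ht jv T
  have hψX (j) := HasDerivAt.fun_sum fun jv (_ : jv ∈ Finset.univ) =>
    HasDerivAt.fun_sum fun T (_ : T ∈ Finset.univ) => hX j jv T
  simp_rw [← hψ'] at hψt hψX
  refine ⟨_, _, hψt, hψX, ?_⟩
  have hEuler (jv T) : ∑ j, lam j * X j * (G jv *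
      (∑ p ∈ T, (∏ q ∈ T.erase p, X (jv q)) * Pi.single (M := fun _ => ℝ) j 1 (jv p)) *
        Real.exp (μ jv T * t) * ∫ s in Set.Iic t, h jv T s)
      = (∑ p ∈ T, lam (jv p)) * (c jv T t X * ∫ s in Set.Iic t, h jv T s) := by
    have := sum_weight_mul_partial_prod T jv lam X
    calc _ = (∑ j, lam j * X j *
          ∑ p ∈ T, (∏ q ∈ T.erase p, X (jv q)) * Pi.single (M := fun _ => ℝ) j 1 (jv p)) *
          (G jv * Real.exp (μ jv T * t) * ∫ s in Set.Iic t, h jv T s) := by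
          rw [Finset.sum_mul]
          exact Finset.sum_congr rfl fun j _ => by ring
      _ = _ := by rw [this]; simp only [hc]; ring
  have hsum : (∑ j, lam j * X j * ∑ jv, ∑ T, (G jv *
      (∑ p ∈ T, (∏ q ∈ T.erase p, X (jv q)) * Pi.single (M := fun _ => ℝ) j 1 (jv p)) *
        Real.exp (μ jv T * t) * ∫ s in Set.Iic t, h jv T s))
      = ∑ jv, ∑ T, (∑ p ∈ T, lam (jv p)) * (c jv T t X * ∫ s in Set.Iic t, h jv T s) := by
    simp_rw [← hEuler]
    simp_rw [Finset.mul_sum (s := (Finset.univ : Finset (Fin k → Fin m))),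
      Finset.mul_sum (s := (Finset.univ : Finset (Finset (Fin k))))]
    rw [Finset.sum_comm]
    exact Finset.sum_congr rfl fun jv _ => Finset.sum_comm
  have hval : Gk (fun j => X j + z t j) = ∑ jv, ∑ T, c jv T t X * h jv T t := by
    simpa using congrFun (hexpand t X) t
  rw [hsum, hval, hψ', Finset.mul_sum]
  simp_rw [Finset.mul_sum]
  rw [← Finset.sum_add_distrib, ← Finset.sum_sub_distrib]
  refine Finset.sum_congr rfl fun jv _ => ?_
  rw [← Finset.sum_add_distrib, ← Finset.sum_sub_distrib]
  refine Finset.sum_congr rfl fun T _ => ?_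
  simp only [hμ]
  ring
end

section
/- Convergence of the backward–forward solutions to the Lyapunov–Perron integral (Step 3 / Eq. (17) of Theorem II.1 of the paper, diagonal real case): Under the hypotheses of the finite-dimensional homological-equation theorem — integers m ≥ 1, k ≥ 1, reals λ_1, …, λ_m, λ_n, a homogeneous degree-k polynomial G_k(x) = Σ_{(j_1,…,j_k)} G^{j_1…j_k} x_{j_1} ⋯ x_{j_k}, a continuous z : ℝ → ℝ^m with each z_j(s)/s → 0 as s → −∞, and the non-resonance condition that λ_n − Σ_{p∈T} λ_{j_p} < 0 for every tuple with G^{j_1…j_k} ≠ 0 and every subset T ⊆ {1,…,k} — define for τ > 0 the backward–forward solution q_τ(t, X) = ∫_{t−τ}^t e^{(t−s)λ_n} G_k( (e^{(s−t)λ_j} X_j + z_j(s))_j ) ds and the Lyapunov–Perron integral ψ(t,X) = ∫_{−∞}^t e^{(t−s)λ_n} G_k( (e^{(s−t)λ_j} X_j + z_j(s))_j ) ds. Then for every t ∈ ℝ and X ∈ ℝ^m, |ψ(t, X) − q_τ(t, X)| → 0 as τ → +∞. -/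
open MeasureTheory Filter intervalIntegral

theorem isBigO_atBot_id_of_tendsto_div {f : ℝ → ℝ}
    (hf : Tendsto (fun s : ℝ => f s / s) atBot (nhds 0)) :
    f =O[atBot] (fun s : ℝ => s) := by
  refine ((Asymptotics.isLittleO_iff_tendsto' ?_).2 hf).isBigO
  filter_upwards [eventually_lt_atBot (0 : ℝ)] with s hs h0
  exact absurd h0 hs.ne

theorem isBigO_pow_exp_neg_mul_atBot (N : ℕ) {b : ℝ} (hb : 0 < b) :
    (fun s : ℝ => s ^ N) =O[atBot] (fun s : ℝ => Real.exp (-b * s)) := by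
  have h := ((isLittleO_pow_exp_pos_mul_atTop N hb).comp_tendsto tendsto_neg_atBot_atTop).isBigO
  refine Asymptotics.IsBigO.of_norm_left ?_
  refine h.norm_left.congr (fun s => ?_) (fun s => ?_)
  · simp [norm_pow]
  · simp

/-- Exponential decay at `-∞` beats a finite product of continuous functions
of at most linear growth. -/
theorem integrableOn_Iic_exp_mul_prod {ι : Type*} (S : Finset ι) (w : ι → ℝ → ℝ)
    (hw_cont : ∀ i ∈ S, Continuous (w i))
    (hw : ∀ i ∈ S, w i =O[atBot] (fun s : ℝ => s)) {c : ℝ} (hc : c < 0) (t : ℝ) :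
    IntegrableOn (fun s => Real.exp ((t - s) * c) * ∏ i ∈ S, w i s) (Set.Iic t) := by
  have hcont : Continuous (fun s => Real.exp ((t - s) * c) * ∏ i ∈ S, w i s) :=
    (by fun_prop : Continuous fun s => Real.exp ((t - s) * c)).mul
      (continuous_finsetProd S hw_cont)
  have hb : 0 < -c / 2 := by linarith
  have hprod : (fun s => ∏ i ∈ S, w i s) =O[atBot] (fun s : ℝ => Real.exp (-(-c / 2) * s)) := by
    refine Asymptotics.IsBigO.trans ?_ (isBigO_pow_exp_neg_mul_atBot S.card hb)
    simpa using Asymptotics.IsBigO.finsetProd hw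
  have hexp : (fun s => Real.exp ((t - s) * c)) =O[atBot] (fun s : ℝ => Real.exp (-c * s)) := by
    refine Asymptotics.IsBigO.of_bound (Real.exp (t * c)) (Eventually.of_forall fun s => ?_)
    rw [Real.norm_of_nonneg (Real.exp_nonneg _), Real.norm_of_nonneg (Real.exp_nonneg _),
      ← Real.exp_add]
    exact (congrArg Real.exp (by ring)).le
  refine (hcont.locallyIntegrable.locallyIntegrableOn _).integrableOn_of_isBigO_atBot
    ((hexp.mul hprod).congr_right fun s => ?_)
    (g := fun s : ℝ => Real.exp (-c / 2 * s))
    ⟨Set.Iic t, Iic_mem_atBot t, integrableOn_exp_mul_Iic hb t⟩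
  rw [← Real.exp_add]
  exact congrArg Real.exp (by ring)

/-- Convergence of the backward–forward solutions to the Lyapunov–Perron integral
(Step 3 / Eq. (17) of Theorem II.1 of the paper, diagonal real case): under the
non-resonance condition, `|ψ(t,X) - q_τ(t,X)| → 0` as `τ → +∞`, where
`q_τ(t,X) = ∫_{t-τ}^t e^{(t-s)λ_n} G_k((e^{(s-t)λ_j} X_j + z_j(s))_j) ds` and
`ψ(t,X)` is the corresponding integral over `(-∞, t]`. -/
theorem bf_solutions_converge_to_lyapunov_perron
    (m k : ℕ) (hm : 1 ≤ m) (hk : 1 ≤ k)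
    (lam : Fin m → ℝ) (lamn : ℝ)
    (G : (Fin k → Fin m) → ℝ)
    (Gk : (Fin m → ℝ) → ℝ)
    (hGk : ∀ x : Fin m → ℝ, Gk x = ∑ jv : Fin k → Fin m, G jv * ∏ p, x (jv p))
    (z : ℝ → Fin m → ℝ) (hz_cont : Continuous z)
    (hz_sub : ∀ j, Tendsto (fun s : ℝ => z s j / s) atBot (nhds 0))
    (hNR : ∀ jv : Fin k → Fin m, G jv ≠ 0 → ∀ T : Finset (Fin k),
      lamn - ∑ p ∈ T, lam (jv p) < 0)
    (qτ : ℝ → ℝ → (Fin m → ℝ) → ℝ)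
    (hqτ : ∀ τ t X, qτ τ t X = ∫ s in (t - τ)..t,
      Real.exp ((t - s) * lamn) *
        Gk (fun j => Real.exp ((s - t) * lam j) * X j + z s j))
    (ψ : ℝ → (Fin m → ℝ) → ℝ)
    (hψ : ∀ t X, ψ t X = ∫ s in Set.Iic t,
      Real.exp ((t - s) * lamn) *
        Gk (fun j => Real.exp ((s - t) * lam j) * X j + z s j)) :
    ∀ t : ℝ, ∀ X : Fin m → ℝ,
      Tendsto (fun τ : ℝ => |ψ t X - qτ τ t X|) atTop (nhds 0) := by
  intro t X
  have hint : IntegrableOn (fun s => Real.exp ((t - s) * lamn) *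
      Gk (fun j => Real.exp ((s - t) * lam j) * X j + z s j)) (Set.Iic t) := by
    have hexpand : ∀ s, Real.exp ((t - s) * lamn) *
        Gk (fun j => Real.exp ((s - t) * lam j) * X j + z s j) =
        ∑ jv : Fin k → Fin m, ∑ T ∈ (Finset.univ : Finset (Fin k)).powerset,
          (G jv * ∏ p ∈ T, X (jv p)) *
            (Real.exp ((t - s) * (lamn - ∑ p ∈ T, lam (jv p))) *
              ∏ p ∈ Finset.univ \ T, z s (jv p)) := by
      intro s
      rw [hGk, Finset.mul_sum]
      refine Finset.sum_congr rfl fun jv _ => ?_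
      rw [Finset.prod_add, Finset.mul_sum, Finset.mul_sum]
      refine Finset.sum_congr rfl fun T _ => ?_
      have hexp : Real.exp ((t - s) * (lamn - ∑ p ∈ T, lam (jv p))) =
          Real.exp ((t - s) * lamn) * ∏ p ∈ T, Real.exp ((s - t) * lam (jv p)) := by
        rw [← Real.exp_sum, ← Real.exp_add, ← Finset.mul_sum]
        exact congrArg Real.exp (by ring)
      rw [hexp, Finset.prod_mul_distrib]
      ring
    simp_rw [hexpand]
    refine integrable_finsetSum _ fun jv _ => integrable_finsetSum _ fun T _ => ?_
    by_cases hG : G jv = 0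
    · simp [hG]
    · exact (integrableOn_Iic_exp_mul_prod _ (fun p s => z s (jv p))
        (fun p _ => (continuous_apply (jv p)).comp hz_cont)
        (fun p _ => isBigO_atBot_id_of_tendsto_div (hz_sub (jv p))) (hNR jv hG T) t).const_mul _
  have hlim := intervalIntegral_tendsto_integral_Iic t hint
    (tendsto_atBot_add_const_left atTop t tendsto_neg_atTop_atBot)
  simp only [← sub_eq_add_neg, ← hqτ, ← hψ] at hlim
  simpa using (hlim.const_sub (ψ t X)).abs
end
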